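/- Let α be a real number with 0 ≤ α < N − 4. Then for every u ∈ C_c^∞(ℍ^N∖{o}) one has ∫_{ℍ^N} (Δ_r u)²/r^α dv ≥ ((N+α)²(N−4−α)²/16) ∫_{ℍ^N} u²/r^{α+4} dv + ((N−1)(N−2−α)(N−2+α)/8) ∫_{ℍ^N} u²/r^{α+2} dv + ((N−1)²/16) ∫_{ℍ^N} u²/r^α dv. -/

import Mathlib

open MeasureTheory Real Set

noncomputable section

/-- The radial derivative `∇_r u = ∂u/∂r` of a function `u(r,σ)`. -/
def radGrad (N : ℕ) (u : ℝ → EuclideanSpace ℝ (Fin N) → ℝ) :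
    ℝ → EuclideanSpace ℝ (Fin N) → ℝ :=
  fun r σ => deriv (fun s => u s σ) r

/-- The radial Laplacian `Δ_r u = ∂²u/∂r² + (N-1) coth r · ∂u/∂r`. -/
def radLap (N : ℕ) (u : ℝ → EuclideanSpace ℝ (Fin N) → ℝ) :
    ℝ → EuclideanSpace ℝ (Fin N) → ℝ :=
  fun r σ => deriv (fun s => deriv (fun t => u t σ) s) r
    + ((N : ℝ) - 1) * (Real.cosh r / Real.sinh r) * deriv (fun s => u s σ) r

/-- The higher order radial derivative `∇_r^k u`: `Δ_r^{k/2} u` for even `k`,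
`∂_r (Δ_r^{(k-1)/2} u)` for odd `k`. -/
def radPow (N k : ℕ) (u : ℝ → EuclideanSpace ℝ (Fin N) → ℝ) :
    ℝ → EuclideanSpace ℝ (Fin N) → ℝ :=
  if Even k then (radLap N)^[k / 2] u else radGrad N ((radLap N)^[k / 2] u)

/-- The integral over the hyperbolic space `ℍ^N` in polar coordinates:
`∫_{S^{N-1}} ∫_0^∞ F(r,σ) (sinh r)^{N-1} dr dσ`, where `dσ` is the standard
surface measure (the `(N-1)`-dimensional Hausdorff measure) on the unit sphere. -/
def hypInt (N : ℕ) (F : ℝ → EuclideanSpace ℝ (Fin N) → ℝ) : ℝ :=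
  ∫ σ in Metric.sphere (0 : EuclideanSpace ℝ (Fin N)) 1,
    (∫ r in Ioi (0 : ℝ), F r σ * Real.sinh r ^ (N - 1)) ∂μH[(N : ℝ) - 1]

/-- `u ∈ C_c^∞(ℍ^N)`: `u(r,σ)` smooth (including at the pole `r = 0`) and
vanishing for all `r` larger than some `R`. -/
def IsCc (N : ℕ) (u : ℝ → EuclideanSpace ℝ (Fin N) → ℝ) : Prop :=
  ContDiff ℝ (⊤ : ℕ∞) (Function.uncurry u) ∧
  ∃ R : ℝ, ∀ r : ℝ, R < r → ∀ σ ∈ Metric.sphere (0 : EuclideanSpace ℝ (Fin N)) 1, u r σ = 0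

/-- `u ∈ C_c^∞(ℍ^N \ {o})`: `u(r,σ)` smooth with support contained in
`[a,b] × S^{N-1}` for some `0 < a ≤ b`. -/
def IsCcAway (N : ℕ) (u : ℝ → EuclideanSpace ℝ (Fin N) → ℝ) : Prop :=
  ContDiff ℝ (⊤ : ℕ∞) (Function.uncurry u) ∧
  ∃ a b : ℝ, 0 < a ∧ a ≤ b ∧
    ∀ r : ℝ, r ∉ Icc a b → ∀ σ ∈ Metric.sphere (0 : EuclideanSpace ℝ (Fin N)) 1, u r σ = 0

lemma nonneg_of_deriv_nonneg_of_zero {f f' : ℝ → ℝ} (hf : ∀ x, HasDerivAt f (f' x) x)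
    (h0 : f 0 = 0) (hf' : ∀ x, 0 ≤ x → 0 ≤ f' x) {x : ℝ} (hx : 0 ≤ x) : 0 ≤ f x := by
  have hm : MonotoneOn f (Ici 0) := by
    refine monotoneOn_of_deriv_nonneg (convex_Ici 0)
      (fun y _ => (hf y).continuousAt.continuousWithinAt)
      (fun y _ => (hf y).differentiableAt.differentiableWithinAt) fun y hy => ?_
    rw [interior_Ici] at hy
    rw [(hf y).deriv]
    exact hf' y hy.le
  simpa [h0] using hm self_mem_Ici hx hx

lemma sinh_le_self_mul_cosh {x : ℝ} (hx : 0 ≤ x) : Real.sinh x ≤ x * Real.cosh x := by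
  have h := nonneg_of_deriv_nonneg_of_zero (f := fun x => x * Real.cosh x - Real.sinh x)
    (f' := fun x => x * Real.sinh x)
    (fun x => (((hasDerivAt_id' x).mul (Real.hasDerivAt_cosh x)).sub
      (Real.hasDerivAt_sinh x)).congr_deriv (by ring))
    (by simp) (fun x hx => mul_nonneg hx (Real.sinh_nonneg_iff.2 hx)) hx
  linarith

lemma self_mul_cosh_le {x : ℝ} (hx : 0 ≤ x) :
    x * Real.cosh x ≤ (1 + x ^ 2 / 3) * Real.sinh x := by
  have h := nonneg_of_deriv_nonneg_of_zero
    (f := fun x => (1 + x ^ 2 / 3) * Real.sinh x - x * Real.cosh x)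
    (f' := fun x => x / 3 * (x * Real.cosh x - Real.sinh x))
    (fun x => (((((hasDerivAt_pow 2 x).div_const 3).const_add 1).mul
      (Real.hasDerivAt_sinh x)).sub
        ((hasDerivAt_id' x).mul (Real.hasDerivAt_cosh x))).congr_deriv (by push_cast; ring))
    (by simp) (fun x hx => mul_nonneg (by positivity) (sub_nonneg.2 (sinh_le_self_mul_cosh hx))) hx
  linarith

lemma three_sub_sq_mul_sinh_sq_le {x : ℝ} (hx : 0 ≤ x) :
    (3 - x ^ 2) * Real.sinh x ^ 2 ≤ 3 * x ^ 2 := by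
  have dS (x : ℝ) : HasDerivAt (fun x => Real.sinh (2 * x)) (2 * Real.cosh (2 * x)) x :=
    ((hasDerivAt_id' x).const_mul 2).sinh.congr_deriv (by ring)
  have dC (x : ℝ) : HasDerivAt (fun x => Real.cosh (2 * x)) (2 * Real.sinh (2 * x)) x :=
    ((hasDerivAt_id' x).const_mul 2).cosh.congr_deriv (by ring)
  have d2 (x : ℝ) : HasDerivAt (fun x : ℝ => x ^ 2) (2 * x) x := by
    simpa using hasDerivAt_pow 2 x
  have third (x : ℝ) (hx : 0 ≤ x) :
      0 ≤ 5 - 5 * Real.cosh (2 * x) + 4 * (x * Real.sinh (2 * x))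
        + 2 * (x ^ 2 * Real.cosh (2 * x)) := by
    refine nonneg_of_deriv_nonneg_of_zero
      (f := fun x => 5 - 5 * Real.cosh (2 * x) + 4 * (x * Real.sinh (2 * x))
        + 2 * (x ^ 2 * Real.cosh (2 * x)))
      (f' := fun x => 6 * (2 * x * Real.cosh (2 * x) - Real.sinh (2 * x))
        + 4 * x ^ 2 * Real.sinh (2 * x)) (fun x => ?_) (by simp) (fun x hx => ?_) hx
    · exact (((((dC x).const_mul 5).const_sub 5).add
        (((hasDerivAt_id' x).mul (dS x)).const_mul 4)).add
        (((d2 x).mul (dC x)).const_mul 2)).congr_deriv (by ring)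
    · have h1 := sinh_le_self_mul_cosh (x := 2 * x) (by positivity)
      have h2 : 0 ≤ Real.sinh (2 * x) := Real.sinh_nonneg_iff.2 (by positivity)
      have h3 : 0 ≤ 4 * x ^ 2 * Real.sinh (2 * x) := by positivity
      linarith
  have second (x : ℝ) (hx : 0 ≤ x) :
      0 ≤ 5 * x + x * Real.cosh (2 * x) - 3 * Real.sinh (2 * x) + x ^ 2 * Real.sinh (2 * x) :=
    nonneg_of_deriv_nonneg_of_zero
      (f := fun x => 5 * x + x * Real.cosh (2 * x) - 3 * Real.sinh (2 * x)
        + x ^ 2 * Real.sinh (2 * x))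
      (fun x => (((((hasDerivAt_id' x).const_mul 5).add ((hasDerivAt_id' x).mul (dC x))).sub
        ((dS x).const_mul 3)).add ((d2 x).mul (dS x))).congr_deriv (by ring))
      (by simp) third hx
  have first : 0 ≤ 3 * x ^ 2 - (3 - x ^ 2) * ((Real.cosh (2 * x) - 1) / 2) :=
    nonneg_of_deriv_nonneg_of_zero
      (f := fun x => 3 * x ^ 2 - (3 - x ^ 2) * ((Real.cosh (2 * x) - 1) / 2))
      (fun x => (((d2 x).const_mul 3).sub (((d2 x).const_sub 3).mul
        (((dC x).sub_const 1).div_const 2))).congr_deriv (by ring))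
      (by simp) second hx
  have h2 : (Real.cosh (2 * x) - 1) / 2 = Real.sinh x ^ 2 := by
    rw [Real.cosh_two_mul, Real.cosh_sq]; ring
  rw [h2] at first
  linarith

lemma coth_bounds {r c : ℝ} (hr : 0 < r) (hc : c = Real.cosh r / Real.sinh r) :
    r⁻¹ ^ 2 ≤ c * r⁻¹ ∧ c * r⁻¹ ≤ r⁻¹ ^ 2 + 1 / 3 ∧ r⁻¹ ^ 2 - 1 / 3 ≤ c ^ 2 - 1 := by
  have hs : 0 < Real.sinh r := Real.sinh_pos_iff.2 hr
  have h1 := sinh_le_self_mul_cosh hr.le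
  have h2 := self_mul_cosh_le hr.le
  have h3 := three_sub_sq_mul_sinh_sq_le hr.le
  have h4 := Real.cosh_sq r
  subst hc
  refine ⟨?_, ?_, ?_⟩
  · rw [← sub_nonneg]
    have : Real.cosh r / Real.sinh r * r⁻¹ - r⁻¹ ^ 2
        = (r * Real.cosh r - Real.sinh r) / (r ^ 2 * Real.sinh r) := by field_simp
    rw [this]
    exact div_nonneg (by linarith) (by positivity)
  · rw [← sub_nonneg]
    have : r⁻¹ ^ 2 + 1 / 3 - Real.cosh r / Real.sinh r * r⁻¹
        = ((1 + r ^ 2 / 3) * Real.sinh r - r * Real.cosh r) / (r ^ 2 * Real.sinh r) := by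
      field_simp
    rw [this]
    exact div_nonneg (by linarith) (by positivity)
  · rw [← sub_nonneg]
    have : (Real.cosh r / Real.sinh r) ^ 2 - 1 - (r⁻¹ ^ 2 - 1 / 3)
        = (3 * r ^ 2 - (3 - r ^ 2) * Real.sinh r ^ 2) / (3 * r ^ 2 * Real.sinh r ^ 2) := by
      rw [div_pow, h4]; field_simp; ring
    rw [this]
    exact div_nonneg (by linarith) (by positivity)

/-- The density, relative to `(sinh r) ^ n / r ^ α`, of the boundary terms that appear when
`∫ (u'' + n coth r u')² (sinh r) ^ n / r ^ α` is integrated by parts; here `c`, `q`, `u`, `f`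
stand for `coth r`, `1 / r`, `u`, `u'`. -/
def rellichFlux (n α c q u f : ℝ) : ℝ :=
  (n * c + (1 + α) * q) / 2 * f ^ 2
    - ((n + 1 + α) ^ 2 / 4 * q ^ 2 * ((n * c - (3 + α) * q) / 2)
      + n * (n - 1) / 6 * ((n * c - (1 + α) * q) / 2)) * u ^ 2

/-- The density, relative to `(sinh r) ^ n / r ^ α`, of the derivative of the product of that
weight with `rellichFlux`; here `g` stands for `u''`. -/
def rellichDiv (n α c q u f g : ℝ) : ℝ :=
  (n * c - α * q) * rellichFlux n α c q u f
    + ((n * (1 - c ^ 2) - (1 + α) * q ^ 2) / 2 * f ^ 2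
      + (n * c + (1 + α) * q) / 2 * (2 * f * g)
      - (((n + 1 + α) ^ 2 / 4 * (-2 * q ^ 3) * ((n * c - (3 + α) * q) / 2)
          + (n + 1 + α) ^ 2 / 4 * q ^ 2 * ((n * (1 - c ^ 2) + (3 + α) * q ^ 2) / 2)
          + n * (n - 1) / 6 * ((n * (1 - c ^ 2) + (1 + α) * q ^ 2) / 2)) * u ^ 2
        + ((n + 1 + α) ^ 2 / 4 * q ^ 2 * ((n * c - (3 + α) * q) / 2)
          + n * (n - 1) / 6 * ((n * c - (1 + α) * q) / 2)) * (2 * u * f)))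

/-- The pointwise inequality behind the radial Rellich inequality. -/
lemma rellich_pointwise {n α c q u f g : ℝ} (hα0 : 0 ≤ α) (hα : α < n - 3)
    (h1 : q ^ 2 ≤ c * q) (h2 : c * q ≤ q ^ 2 + 1 / 3) (h3 : q ^ 2 - 1 / 3 ≤ c ^ 2 - 1) :
    (n + 1 + α) ^ 2 * (n - 3 - α) ^ 2 / 16 * (q ^ 4 * u ^ 2)
      + n * (n - 1 - α) * (n - 1 + α) / 8 * (q ^ 2 * u ^ 2) + n ^ 2 / 16 * u ^ 2
      + rellichDiv n α c q u f g
      ≤ (g + n * c * f) ^ 2 := by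
  have hn : 0 < n - 3 := by linarith
  have hn0 : 0 ≤ n := by linarith
  have hm : 0 ≤ n * (n - 1) / 6 := by
    have : 0 ≤ n - 1 := by linarith
    positivity
  have bK : (n + 1 + α) ^ 2 / 4 * q ^ 2 + n * (n - 1) / 6
      ≤ n ^ 2 / 4 + n * (n + 2) / 4 * (c ^ 2 - 1) + n * α / 2 * (c * q) + (α + 1) ^ 2 / 4 * q ^ 2 := by
    have e1 := mul_le_mul_of_nonneg_left h3 (show 0 ≤ n * (n + 2) / 4 by positivity)
    have e2 := mul_le_mul_of_nonneg_left h1 (show 0 ≤ n * α / 2 by positivity)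
    linarith
  have bB (β : ℝ) (hβ : 0 ≤ β) : (n - 1 - β) ^ 2 / 4 * q ^ 2 + n * (n + 1 - β) / 6
      ≤ n ^ 2 / 4 + n * (n - 2) / 4 * (c ^ 2 - 1) - n * β / 2 * (c * q) + (β + 1) ^ 2 / 4 * q ^ 2 := by
    have h5 : 0 ≤ n - 2 := by linarith
    have e1 := mul_le_mul_of_nonneg_left h3 (show 0 ≤ n * (n - 2) / 4 by positivity)
    have e2 := mul_le_mul_of_nonneg_left h2 (show 0 ≤ n * β / 2 by positivity)
    linarith
  have b1 := mul_le_mul_of_nonneg_left (bB (α + 2) (by linarith))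
    (show 0 ≤ (n + 1 + α) ^ 2 / 4 * q ^ 2 by positivity)
  have b0 := mul_le_mul_of_nonneg_left (bB α hα0) hm
  have k2 : n * (n - 1 - α) * (n - 1 + α) / 8 * q ^ 2
      ≤ (n + 1 + α) ^ 2 / 4 * q ^ 2 * (n * (n + 1 - (α + 2)) / 6) := by
    have : 0 ≤ n - 1 - α := by linarith
    have h6 : 0 ≤ (n + 1 + α) ^ 2 - 3 * (n - 1 + α) := by nlinarith
    have h7 : 0 ≤ n * (n - 1 - α) / 24 * q ^ 2 * ((n + 1 + α) ^ 2 - 3 * (n - 1 + α)) := by positivity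
    linarith
  have k3 : n ^ 2 / 16 ≤ n * (n - 1) / 6 * ((n - 1 - α) ^ 2 / 4 * q ^ 2 + n * (n + 1 - α) / 6) := by
    have h8 : 2 * 4 ≤ (n - 1) * (n + 1 - α) := by
      apply mul_le_mul <;> linarith
    have h9 : 0 ≤ n * (n - 1) / 6 * ((n - 1 - α) ^ 2 / 4 * q ^ 2) := by positivity
    have h10 := mul_le_mul_of_nonneg_left h8 (sq_nonneg n)
    nlinarith
  have hu := mul_le_mul_of_nonneg_right (add_le_add (add_le_add b1 b0) (add_le_add k2 k3))
    (sq_nonneg u)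
  have hf := mul_le_mul_of_nonneg_right bK (sq_nonneg f)
  have s1 := sq_nonneg (g + (n * c - (1 + α) * q) / 2 * f)
  have s2 : 0 ≤ (n + 1 + α) ^ 2 / 4 * q ^ 2 * (f + (n * c - (3 + α) * q) / 2 * u) ^ 2 := by
    positivity
  have s3 : 0 ≤ n * (n - 1) / 6 * (f + (n * c - (1 + α) * q) / 2 * u) ^ 2 := by positivity
  unfold rellichDiv rellichFlux
  linarith

lemma hasDerivAt_sinh_pow_div_rpow (n : ℕ) (α : ℝ) {r : ℝ} (hr : 0 < r) :
    HasDerivAt (fun r => Real.sinh r ^ n / r ^ α)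
      (Real.sinh r ^ n / r ^ α * (n * (Real.cosh r / Real.sinh r) - α * r⁻¹)) r := by
  have hs : Real.sinh r ≠ 0 := (Real.sinh_pos_iff.2 hr).ne'
  have hrα : r ^ α ≠ 0 := (Real.rpow_pos_of_pos hr α).ne'
  refine (((Real.hasDerivAt_sinh r).pow n).div
    (Real.hasDerivAt_rpow_const (p := α) (Or.inl hr.ne')) hrα).congr_deriv ?_
  rw [Real.rpow_sub_one hr.ne']
  rcases n with _ | n
  · simp
    field_simp
  · simp only [Nat.add_sub_cancel, Pi.pow_apply]
    field_simp
    ring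

lemma hasDerivAt_coth {r : ℝ} (hr : 0 < r) :
    HasDerivAt (fun r => Real.cosh r / Real.sinh r) (1 - (Real.cosh r / Real.sinh r) ^ 2) r := by
  have hs : Real.sinh r ≠ 0 := (Real.sinh_pos_iff.2 hr).ne'
  refine ((Real.hasDerivAt_cosh r).div (Real.hasDerivAt_sinh r) hs).congr_deriv ?_
  field_simp

lemma hasDerivAt_mul_rellichFlux {n α : ℝ} {W c q u f : ℝ → ℝ} {g r : ℝ}
    (hW : HasDerivAt W (W r * (n * c r - α * q r)) r) (hc : HasDerivAt c (1 - c r ^ 2) r)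
    (hq : HasDerivAt q (-q r ^ 2) r) (hu : HasDerivAt u (f r) r) (hf : HasDerivAt f g r) :
    HasDerivAt (fun r => W r * rellichFlux n α (c r) (q r) (u r) (f r))
      (W r * rellichDiv n α (c r) (q r) (u r) (f r) g) r := by
  unfold rellichFlux rellichDiv rellichFlux
  refine (hW.mul (((((hc.const_mul n).add (hq.const_mul (1 + α))).div_const 2).mul
    (hf.pow 2)).sub (((((hq.pow 2).const_mul ((n + 1 + α) ^ 2 / 4)).mul
      (((hc.const_mul n).sub (hq.const_mul (3 + α))).div_const 2)).add
      ((((hc.const_mul n).sub (hq.const_mul (1 + α))).div_const 2).const_mul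
        (n * (n - 1) / 6))).mul (hu.pow 2)))).congr_deriv ?_
  simp only [Pi.pow_apply, Pi.mul_apply, Pi.add_apply, Pi.sub_apply]
  push_cast
  ring

lemma setIntegral_Ioi_eq_intervalIntegral {F : ℝ → ℝ} {a b a' b' : ℝ} (ha : a' < a) (ha' : 0 ≤ a')
    (hab : a ≤ b) (hb : b ≤ b') (hF : ∀ r, r ∉ Icc a b → F r = 0) :
    ∫ r in Ioi (0 : ℝ), F r = ∫ r in a'..b', F r := by
  rw [intervalIntegral.integral_of_le (by linarith)]
  refine setIntegral_eq_of_subset_of_forall_sdiff_eq_zero measurableSet_Ioi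
    (fun r hr => lt_of_le_of_lt ha' hr.1) fun r hr => hF r fun h => hr.2 ⟨?_, ?_⟩
  · linarith [h.1]
  · linarith [h.2]

lemma deriv_eq_zero_of_notMem_Icc {v : ℝ → ℝ} {a b : ℝ} (hv : ∀ r, r ∉ Icc a b → v r = 0)
    (r : ℝ) (hr : r ∉ Icc a b) : deriv v r = 0 := by
  have h : v =ᶠ[nhds r] fun _ => 0 := by
    filter_upwards [isClosed_Icc.isOpen_compl.mem_nhds hr] with s hs using hv s hs
  rw [h.deriv_eq, deriv_const]

/-- The radial Rellich inequality on a single ray. -/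
lemma rellich_on_ray (n : ℕ) {α : ℝ} (hα0 : 0 ≤ α) (hα : α < (n : ℝ) - 3) {v : ℝ → ℝ}
    (hv : ContDiff ℝ 2 v) {a b : ℝ} (ha : 0 < a) (hab : a ≤ b)
    (hsupp : ∀ r, r ∉ Icc a b → v r = 0) :
    ((n : ℝ) + 1 + α) ^ 2 * (n - 3 - α) ^ 2 / 16
        * (∫ r in Ioi (0 : ℝ), v r ^ 2 / r ^ (α + 4) * Real.sinh r ^ n)
      + (n : ℝ) * (n - 1 - α) * (n - 1 + α) / 8
        * (∫ r in Ioi (0 : ℝ), v r ^ 2 / r ^ (α + 2) * Real.sinh r ^ n)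
      + (n : ℝ) ^ 2 / 16 * (∫ r in Ioi (0 : ℝ), v r ^ 2 / r ^ α * Real.sinh r ^ n)
      ≤ ∫ r in Ioi (0 : ℝ), (deriv (deriv v) r
        + n * (Real.cosh r / Real.sinh r) * deriv v r) ^ 2 / r ^ α * Real.sinh r ^ n := by
  have hsupp' := deriv_eq_zero_of_notMem_Icc hsupp
  have hsupp'' := deriv_eq_zero_of_notMem_Icc hsupp'
  have hv' : ContDiff ℝ 1 (deriv v) := hv.deriv'
  have hcv := hv.continuous
  have hcv' := hv'.continuous
  have hcv'' : Continuous (deriv (deriv v)) := hv'.continuous_deriv le_rfl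
  have key {F : ℝ → ℝ} (hF : ∀ r, r ∉ Icc a b → F r = 0) :
      ∫ r in Ioi (0 : ℝ), F r = ∫ r in (a / 2)..(b + 1), F r :=
    setIntegral_Ioi_eq_intervalIntegral (by linarith) (by linarith) hab (by linarith) hF
  rw [key fun r hr => by simp [hsupp r hr], key fun r hr => by simp [hsupp r hr],
    key fun r hr => by simp [hsupp r hr], key fun r hr => by simp [hsupp' r hr, hsupp'' r hr]]
  have hle : a / 2 ≤ b + 1 := by linarith
  have hpos : ∀ r ∈ Icc (a / 2) (b + 1), 0 < r := fun r hr => by linarith [hr.1]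
  obtain ⟨W, hW⟩ : ∃ W : ℝ → ℝ, W = fun r => Real.sinh r ^ n / r ^ α := ⟨_, rfl⟩
  obtain ⟨c, hc⟩ : ∃ c : ℝ → ℝ, c = fun r => Real.cosh r / Real.sinh r := ⟨_, rfl⟩
  obtain ⟨q, hq⟩ : ∃ q : ℝ → ℝ, q = fun r => r⁻¹ := ⟨_, rfl⟩
  have dW (r : ℝ) (hr : r ∈ Icc (a / 2) (b + 1)) : HasDerivAt W (W r * (n * c r - α * q r)) r := by
    subst hW hc hq
    exact hasDerivAt_sinh_pow_div_rpow n α (hpos r hr)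
  have dc (r : ℝ) (hr : r ∈ Icc (a / 2) (b + 1)) : HasDerivAt c (1 - c r ^ 2) r := by
    subst hc
    exact hasDerivAt_coth (hpos r hr)
  have dq (r : ℝ) (hr : r ∈ Icc (a / 2) (b + 1)) : HasDerivAt q (-q r ^ 2) r := by
    subst hq
    simpa using hasDerivAt_inv (hpos r hr).ne'
  have cW : ContinuousOn W (Icc (a / 2) (b + 1)) :=
    fun r hr => (dW r hr).continuousAt.continuousWithinAt
  have cc : ContinuousOn c (Icc (a / 2) (b + 1)) :=
    fun r hr => (dc r hr).continuousAt.continuousWithinAt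
  have cq : ContinuousOn q (Icc (a / 2) (b + 1)) :=
    fun r hr => (dq r hr).continuousAt.continuousWithinAt
  have e4 (r : ℝ) (hr : r ∈ Icc (a / 2) (b + 1)) :
      v r ^ 2 / r ^ (α + 4) * Real.sinh r ^ n = W r * (q r ^ 4 * v r ^ 2) := by
    subst hW hq
    rw [show α + 4 = α + (4 : ℕ) by norm_num, Real.rpow_add_natCast (hpos r hr).ne']
    field_simp
  have e2 (r : ℝ) (hr : r ∈ Icc (a / 2) (b + 1)) :
      v r ^ 2 / r ^ (α + 2) * Real.sinh r ^ n = W r * (q r ^ 2 * v r ^ 2) := by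
    subst hW hq
    rw [show α + 2 = α + (2 : ℕ) by norm_num, Real.rpow_add_natCast (hpos r hr).ne']
    field_simp
  have e0 (r : ℝ) : v r ^ 2 / r ^ α * Real.sinh r ^ n = W r * v r ^ 2 := by
    subst hW
    ring
  have eL (r : ℝ) : (deriv (deriv v) r
      + n * (Real.cosh r / Real.sinh r) * deriv v r) ^ 2 / r ^ α * Real.sinh r ^ n
      = W r * (deriv (deriv v) r + n * c r * deriv v r) ^ 2 := by
    subst hW hc
    ring
  have hI : uIcc (a / 2) (b + 1) = Icc (a / 2) (b + 1) := uIcc_of_le hle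
  rw [intervalIntegral.integral_congr fun r hr => e4 r (hI ▸ hr),
    intervalIntegral.integral_congr fun r hr => e2 r (hI ▸ hr)]
  simp only [e0, eL]
  have iD : IntervalIntegrable (fun r => W r * rellichDiv n α (c r) (q r) (v r) (deriv v r)
      (deriv (deriv v) r)) volume (a / 2) (b + 1) := by
    refine ContinuousOn.intervalIntegrable_of_Icc hle ?_
    unfold rellichDiv rellichFlux
    fun_prop
  have hdiv : ∫ r in (a / 2)..(b + 1),
      W r * rellichDiv n α (c r) (q r) (v r) (deriv v r) (deriv (deriv v) r) = 0 := by
    rw [intervalIntegral.integral_eq_sub_of_hasDerivAt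
      (f := fun r => W r * rellichFlux n α (c r) (q r) (v r) (deriv v r))]
    · have h1 : b + 1 ∉ Icc a b := fun h => by linarith [h.2]
      have h2 : a / 2 ∉ Icc a b := fun h => by linarith [h.1]
      simp [rellichFlux, hsupp _ h1, hsupp _ h2, hsupp' _ h1, hsupp' _ h2]
    · intro r hr
      rw [hI] at hr
      exact hasDerivAt_mul_rellichFlux (dW r hr) (dc r hr) (dq r hr)
        (hv.differentiable (by norm_num) r).hasDerivAt
        (hv'.differentiable (by norm_num) r).hasDerivAt
    · exact iD
  have i4 : IntervalIntegrable (fun r => W r * (q r ^ 4 * v r ^ 2)) volume (a / 2) (b + 1) :=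
    ContinuousOn.intervalIntegrable_of_Icc hle (by fun_prop)
  have i2 : IntervalIntegrable (fun r => W r * (q r ^ 2 * v r ^ 2)) volume (a / 2) (b + 1) :=
    ContinuousOn.intervalIntegrable_of_Icc hle (by fun_prop)
  have i0 : IntervalIntegrable (fun r => W r * v r ^ 2) volume (a / 2) (b + 1) :=
    ContinuousOn.intervalIntegrable_of_Icc hle (by fun_prop)
  rw [← add_zero (_ + _ + _), ← hdiv, ← intervalIntegral.integral_const_mul,
    ← intervalIntegral.integral_const_mul, ← intervalIntegral.integral_const_mul,
    ← intervalIntegral.integral_add (i4.const_mul _) (i2.const_mul _),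
    ← intervalIntegral.integral_add ((i4.const_mul _).add (i2.const_mul _)) (i0.const_mul _),
    ← intervalIntegral.integral_add
      (((i4.const_mul _).add (i2.const_mul _)).add (i0.const_mul _)) iD]
  refine intervalIntegral.integral_mono_on hle
    ((((i4.const_mul _).add (i2.const_mul _)).add (i0.const_mul _)).add iD)
    (ContinuousOn.intervalIntegrable_of_Icc hle (by fun_prop)) fun r hr => ?_
  have hWr : 0 ≤ W r := by
    subst hW
    have := Real.sinh_pos_iff.2 (hpos r hr)
    have := Real.rpow_pos_of_pos (hpos r hr) α
    positivity
  obtain ⟨h1, h2, h3⟩ := coth_bounds (hpos r hr) (congrFun hc r)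
  rw [show r⁻¹ = q r by rw [hq]] at h1 h2 h3
  have := mul_le_mul_of_nonneg_left (rellich_pointwise (u := v r) (f := deriv v r)
    (g := deriv (deriv v) r) hα0 hα h1 h2 h3) hWr
  linarith

/-- The unit sphere of `EuclideanSpace ℝ (Fin (n + 1))` has finite `n`-dimensional Hausdorff
measure: it is covered by the radial projections of the faces of a cube. -/
lemma hausdorffMeasure_sphere_lt_top (n : ℕ) :
    μH[(n : ℝ)] (Metric.sphere (0 : EuclideanSpace ℝ (Fin (n + 1))) 1) < ⊤ := by
  let y (i : Fin (n + 1)) (e : ℝ) (v : Fin n → ℝ) : EuclideanSpace ℝ (Fin (n + 1)) :=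
    WithLp.toLp 2 (i.insertNth e v)
  let p (i : Fin (n + 1)) (e : ℝ) (v : Fin n → ℝ) : EuclideanSpace ℝ (Fin (n + 1)) :=
    ‖y i e v‖⁻¹ • y i e v
  let K : Set (Fin n → ℝ) := Icc (fun _ => -1) (fun _ => 1)
  have hy (i : Fin (n + 1)) (e : ℝ) : ContDiff ℝ 1 (y i e) := by
    rw [contDiff_piLp]
    intro j
    refine Fin.succAboveCases i ?_ (fun k => ?_) j
    · simpa [y] using contDiff_const
    · simpa [y] using contDiff_apply ℝ ℝ k
  have hne (i : Fin (n + 1)) (e : ℝ) (he : e ≠ 0) (v : Fin n → ℝ) : y i e v ≠ 0 := fun h =>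
    he (by simpa [y] using congrArg (fun z : EuclideanSpace ℝ (Fin (n + 1)) => z i) h)
  have hp (i : Fin (n + 1)) (e : ℝ) (he : e ≠ 0) : μH[(n : ℝ)] (p i e '' K) < ⊤ := by
    have hc : ContDiff ℝ 1 (p i e) :=
      (((hy i e).norm ℝ (hne i e he)).inv fun v => norm_ne_zero_iff.2 (hne i e he v)).smul (hy i e)
    obtain ⟨C, hC⟩ := LocallyLipschitzOn.exists_lipschitzOnWith_of_compact (s := K) isCompact_Icc
      hc.locallyLipschitz.locallyLipschitzOn
    refine (hC.hausdorffMeasure_image_le n.cast_nonneg).trans_lt ?_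
    have hvol : μH[(n : ℝ)] K < ⊤ := by
      have h := hausdorffMeasure_pi_real (ι := Fin n)
      rw [Fintype.card_fin] at h
      rw [h]
      exact isCompact_Icc.measure_lt_top
    exact ENNReal.mul_lt_top (ENNReal.rpow_lt_top_of_nonneg n.cast_nonneg ENNReal.coe_ne_top) hvol
  have hcover : Metric.sphere (0 : EuclideanSpace ℝ (Fin (n + 1))) 1
      ⊆ ⋃ i : Fin (n + 1), (p i 1 '' K ∪ p i (-1) '' K) := by
    intro x hx
    have hx1 : ‖x‖ = 1 := by simpa using hx
    obtain ⟨i, -, hi⟩ := Finset.exists_max_image Finset.univ (fun i => |x i|) Finset.univ_nonempty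
    have hxi : 0 < |x i| := by
      refine (abs_nonneg _).lt_of_ne' fun h => ?_
      have : x = 0 := by
        ext j
        have := hi j (Finset.mem_univ j)
        rw [h] at this
        simpa using this
      simp [this] at hx1
    have hmem (e : ℝ) (he : e = x i / |x i|) : x ∈ p i e '' K := by
      refine ⟨fun k => x (i.succAbove k) / |x i|, ?_, ?_⟩
      · refine ⟨fun k => ?_, fun k => ?_⟩
        all_goals
          have := abs_le.1 (hi (i.succAbove k) (Finset.mem_univ _))
        · change -1 ≤ x (i.succAbove k) / |x i|
          rw [le_div_iff₀ hxi]; linarith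
        · change x (i.succAbove k) / |x i| ≤ 1
          rw [div_le_iff₀ hxi]; linarith
      · have hyx : y i e (fun k => x (i.succAbove k) / |x i|) = |x i|⁻¹ • x := by
          ext j
          refine Fin.succAboveCases i ?_ (fun k => ?_) j
          · simp [y, he, div_eq_inv_mul]
          · simp [y, div_eq_inv_mul]
        simp only [p, hyx, norm_smul, hx1, norm_inv, Real.norm_eq_abs, abs_abs, mul_one, inv_inv]
        rw [smul_smul, mul_inv_cancel₀ hxi.ne', one_smul]
    refine mem_iUnion.2 ⟨i, ?_⟩
    rcases abs_cases (x i) with ⟨h, -⟩ | ⟨h, -⟩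
    · exact Or.inl (hmem 1 (by rw [← h, abs_abs, div_self hxi.ne']))
    · refine Or.inr (hmem (-1) ?_)
      rw [eq_div_iff hxi.ne', h]
      ring
  refine (measure_mono hcover).trans_lt ((measure_iUnion_le _).trans_lt ?_)
  rw [tsum_fintype]
  exact ENNReal.sum_lt_top.2 fun i _ => (measure_union_le _ _).trans_lt
    (ENNReal.add_lt_top.2 ⟨hp i 1 one_ne_zero, hp i (-1) (by norm_num)⟩)

lemma integrableOn_sphere_integral_Ioi (n : ℕ) {F : ℝ → EuclideanSpace ℝ (Fin (n + 1)) → ℝ}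
    (hF : ContinuousOn (Function.uncurry F) (Ioi 0 ×ˢ univ)) {a b : ℝ} (ha : 0 < a) (hab : a ≤ b)
    (hsupp : ∀ r, r ∉ Icc a b →
      ∀ σ ∈ Metric.sphere (0 : EuclideanSpace ℝ (Fin (n + 1))) 1, F r σ = 0) :
    IntegrableOn (fun σ => ∫ r in Ioi (0 : ℝ), F r σ) (Metric.sphere 0 1) μH[(n : ℝ)] := by
  have hcont : Continuous fun σ => ∫ r in (a / 2)..(b + 1), F (max r (a / 2)) σ := by
    refine intervalIntegral.continuous_parametric_intervalIntegral_of_continuous'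
      (f := fun σ r => F (max r (a / 2)) σ) ?_ _ _
    refine hF.comp_continuous (f := fun p : EuclideanSpace ℝ (Fin (n + 1)) × ℝ =>
      (max p.2 (a / 2), p.1)) (by fun_prop) fun p => ⟨?_, mem_univ _⟩
    exact lt_of_lt_of_le (half_pos ha) (le_max_right _ _)
  have hmeas : MeasurableSet (Metric.sphere (0 : EuclideanSpace ℝ (Fin (n + 1))) 1) :=
    Metric.isClosed_sphere.measurableSet
  have heq : EqOn (fun σ => ∫ r in (a / 2)..(b + 1), F (max r (a / 2)) σ)
      (fun σ => ∫ r in Ioi (0 : ℝ), F r σ) (Metric.sphere 0 1) := by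
    intro σ hσ
    simp only
    rw [setIntegral_Ioi_eq_intervalIntegral (a' := a / 2) (b' := b + 1) (by linarith) (by linarith)
      hab (by linarith) fun r hr => hsupp r hr σ hσ]
    refine intervalIntegral.integral_congr fun r hr => ?_
    rw [uIcc_of_le (by linarith)] at hr
    simp only [max_eq_left hr.1]
  refine IntegrableOn.congr_fun ?_ heq hmeas
  obtain ⟨M, hM⟩ := IsCompact.exists_bound_of_continuousOn
    (isCompact_sphere (0 : EuclideanSpace ℝ (Fin (n + 1))) 1) hcont.continuousOn
  exact Measure.integrableOn_of_bounded (hausdorffMeasure_sphere_lt_top n).ne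
    hcont.aestronglyMeasurable ((ae_restrict_iff' hmeas).2 (.of_forall hM))

lemma contDiff_uncurry_radGrad {N : ℕ} {u : ℝ → EuclideanSpace ℝ (Fin N) → ℝ}
    (hu : ContDiff ℝ (⊤ : ℕ∞) (Function.uncurry u)) :
    ContDiff ℝ (⊤ : ℕ∞) (Function.uncurry (radGrad N u)) := by
  have h : Function.uncurry (radGrad N u) = fun p => fderiv ℝ (Function.uncurry u) p (1, 0) := by
    ext ⟨r, σ⟩
    have h1 : HasFDerivAt (Function.uncurry u) (fderiv ℝ (Function.uncurry u) (r, σ)) (r, σ) :=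
      (hu.differentiable (by simp) (r, σ)).hasFDerivAt
    exact (h1.comp_hasDerivAt r ((hasDerivAt_id r).prodMk (hasDerivAt_const r σ))).deriv
  rw [h]
  exact (hu.fderiv_right (m := (⊤ : ℕ∞)) (by exact_mod_cast le_rfl)).clm_apply contDiff_const
/-- Improved weighted Rellich inequality with three Hardy-type terms on `ℍ^N`,
for `0 ≤ α < N-4`. -/
theorem weighted_radial_rellich_improved (N : ℕ) (α : ℝ)
    (hα0 : 0 ≤ α) (hα : α < (N : ℝ) - 4)
    (u : ℝ → EuclideanSpace ℝ (Fin N) → ℝ) (hu : IsCcAway N u) :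
    hypInt N (fun r σ => (radLap N u r σ) ^ 2 / r ^ α) ≥
      (((N : ℝ) + α) ^ 2 * ((N : ℝ) - 4 - α) ^ 2 / 16) *
          hypInt N (fun r σ => (u r σ) ^ 2 / r ^ (α + 4))
      + (((N : ℝ) - 1) * ((N : ℝ) - 2 - α) * ((N : ℝ) - 2 + α) / 8) *
          hypInt N (fun r σ => (u r σ) ^ 2 / r ^ (α + 2))
      + (((N : ℝ) - 1) ^ 2 / 16) * hypInt N (fun r σ => (u r σ) ^ 2 / r ^ α) := by
  obtain ⟨n, rfl⟩ : ∃ n, N = n + 1 :=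
    Nat.exists_eq_succ_of_ne_zero fun h => by subst h; norm_num at hα; linarith
  obtain ⟨hu, a, b, ha, hab, hsupp⟩ := hu
  have hn : ((n + 1 : ℕ) : ℝ) = (n : ℝ) + 1 := by push_cast; ring
  have hu1 : Continuous (Function.uncurry (radGrad (n + 1) u)) :=
    (contDiff_uncurry_radGrad hu).continuous
  have hu2 : Continuous (Function.uncurry (radGrad (n + 1) (radGrad (n + 1) u))) :=
    (contDiff_uncurry_radGrad (contDiff_uncurry_radGrad hu)).continuous
  have hu0 := hu.continuous
  have hpow (β : ℝ) : ContinuousOn (fun p : ℝ × EuclideanSpace ℝ (Fin (n + 1)) => p.1 ^ β)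
      (Ioi 0 ×ˢ univ) := fun p hp =>
    ((Real.continuousAt_rpow_const p.1 β (Or.inl (ne_of_gt hp.1))).comp
      continuousAt_fst).continuousWithinAt
  have hpow0 (β : ℝ) (p : ℝ × EuclideanSpace ℝ (Fin (n + 1))) (hp : p ∈ Ioi (0 : ℝ) ×ˢ univ) :
      p.1 ^ β ≠ 0 := (Real.rpow_pos_of_pos hp.1 β).ne'
  have hsinh : Continuous fun p : ℝ × EuclideanSpace ℝ (Fin (n + 1)) => Real.sinh p.1 :=
    Real.continuous_sinh.comp continuous_fst
  have hcosh : Continuous fun p : ℝ × EuclideanSpace ℝ (Fin (n + 1)) => Real.cosh p.1 :=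
    Real.continuous_cosh.comp continuous_fst
  have hint (β : ℝ) : IntegrableOn
      (fun σ => ∫ r in Ioi (0 : ℝ), u r σ ^ 2 / r ^ β * Real.sinh r ^ n)
      (Metric.sphere 0 1) μH[(n : ℝ)] :=
    integrableOn_sphere_integral_Ioi n (F := fun r σ => u r σ ^ 2 / r ^ β * Real.sinh r ^ n)
      (((hu0.pow 2).continuousOn.div (hpow β) (hpow0 β)).mul (hsinh.pow n).continuousOn)
      ha hab fun r hr σ hσ => by simp [hsupp r hr σ hσ]
  have hlap : IntegrableOn (fun σ => ∫ r in Ioi (0 : ℝ), (radGrad (n + 1) (radGrad (n + 1) u) r σ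
      + n * (Real.cosh r / Real.sinh r) * radGrad (n + 1) u r σ) ^ 2 / r ^ α * Real.sinh r ^ n)
      (Metric.sphere 0 1) μH[(n : ℝ)] := by
    refine integrableOn_sphere_integral_Ioi n (F := fun r σ =>
      (radGrad (n + 1) (radGrad (n + 1) u) r σ + n * (Real.cosh r / Real.sinh r)
        * radGrad (n + 1) u r σ) ^ 2 / r ^ α * Real.sinh r ^ n)
      ((((hu2.continuousOn.add ((continuousOn_const.mul (hcosh.continuousOn.div hsinh.continuousOn
        fun p hp => (Real.sinh_pos_iff.2 hp.1).ne')).mul hu1.continuousOn)).pow 2).div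
        (hpow α) (hpow0 α)).mul (hsinh.pow n).continuousOn)
      ha hab fun r hr σ hσ => ?_
    have h0 : ∀ r, r ∉ Icc a b → (fun s => u s σ) r = 0 := fun r hr => hsupp r hr σ hσ
    have h1 : ∀ r, r ∉ Icc a b → (fun s => radGrad (n + 1) u s σ) r = 0 :=
      deriv_eq_zero_of_notMem_Icc h0
    have h2 : radGrad (n + 1) (radGrad (n + 1) u) r σ = 0 := deriv_eq_zero_of_notMem_Icc h1 r hr
    have h1r : radGrad (n + 1) u r σ = 0 := h1 r hr
    simp [h2, h1r]
  unfold hypInt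
  simp only [Nat.add_sub_cancel, hn, add_sub_cancel_right]
  rw [ge_iff_le, ← integral_const_mul, ← integral_const_mul, ← integral_const_mul,
    ← integral_add ((hint _).const_mul _) ((hint _).const_mul _),
    ← integral_add (((hint _).const_mul _).fun_add ((hint _).const_mul _)) ((hint _).const_mul _)]
  refine setIntegral_mono_on
    ((((hint _).const_mul _).add ((hint _).const_mul _)).add ((hint _).const_mul _))
    (by simpa only [radLap, radGrad, hn, add_sub_cancel_right] using hlap)
    Metric.isClosed_sphere.measurableSet fun σ hσ => ?_
  have h := rellich_on_ray n hα0 (by rw [hn] at hα; linarith) (v := fun r => u r σ)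
    (contDiff_infty.1 (hu.comp (contDiff_prodMk_left σ)) 2) ha hab
    fun r hr => hsupp r hr σ hσ
  simp only [radLap, hn, add_sub_cancel_right]
  rw [show (n : ℝ) + 1 - 4 - α = n - 3 - α by ring, show (n : ℝ) + 1 - 2 - α = n - 1 - α by ring,
    show (n : ℝ) + 1 - 2 + α = n - 1 + α by ring]
  exact h
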